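/- Let Q = p + (α+1)q and define Γ(z) = ‖z‖^{2−Q} for z ≠ (0,0). Then Γ is a solution of the Grushin equation Δ_α Γ = 0 away from the origin: for every z = (x,y) with x ≠ 0, Δ_x Γ(z) + (α+1)² |x|^{2α} Δ_y Γ(z) = 0, where Δ_x and Δ_y denote the Laplacians in the x and y variables respectively. -/

import Mathlib

noncomputable section

open scoped RealInnerProductSpace

/-- Points/tangent vectors of `M = ℝ^p × ℝ^q` with Euclidean norms on the factors. -/
abbrev GVec (p q : ℕ) := EuclideanSpace ℝ (Fin p) × EuclideanSpace ℝ (Fin q)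

/-- The set `M₀ = (ℝ^p \ {0}) × ℝ^q`. -/
def GM0 (p q : ℕ) : Set (GVec p q) := {z | z.1 ≠ 0}

/-- Homogeneous norm `‖(x,y)‖ = (|x|^{2(α+1)} + |y|²)^{1/(2(α+1))}`. -/
def homNorm (α : ℝ) (p q : ℕ) (z : GVec p q) : ℝ :=
  (‖z.1‖ ^ (2 * (α + 1)) + ‖z.2‖ ^ 2) ^ (1 / (2 * (α + 1)))

/-- Anisotropic dilation `δ_t(x,y) = (t x, t^{α+1} y)`. -/
def gdil (α : ℝ) (p q : ℕ) (t : ℝ) (z : GVec p q) : GVec p q :=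
  (t • z.1, (t ^ (α + 1)) • z.2)

/-- Grushin inversion `Φ(z) = δ_{‖z‖^{-2}} z = (x/‖z‖², y/‖z‖^{2(α+1)})`. -/
def ginv (α : ℝ) (p q : ℕ) (z : GVec p q) : GVec p q :=
  ((homNorm α p q z ^ (-(2:ℝ))) • z.1, (homNorm α p q z ^ (-(2 * (α + 1)))) • z.2)

/-- The Riemannian metric `g = (α+1)²|x|^{2α}|dx|² + |dy|²` (depends on the point through `x`). -/
def gMet (α : ℝ) (p q : ℕ) (x : EuclideanSpace ℝ (Fin p)) (U V : GVec p q) : ℝ :=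
  (α + 1) ^ 2 * ‖x‖ ^ (2 * α) * ⟪U.1, V.1⟫ + ⟪U.2, V.2⟫

/-- The Riemannian metric `ĝ = |dx|² + |dy|²/((α+1)²|x|^{2α})`. -/
def ghat (α : ℝ) (p q : ℕ) (x : EuclideanSpace ℝ (Fin p)) (U V : GVec p q) : ℝ :=
  ⟪U.1, V.1⟫ + ⟪U.2, V.2⟫ / ((α + 1) ^ 2 * ‖x‖ ^ (2 * α))

/-- Contraction `Γ(U,V)^k = Γ^k_{ij}U^iV^j` of the Christoffel symbols
`Γ^k_{ij} = α|x|^{-2}(δ_{ik}x_j + δ_{jk}x_i − δ_{ij}x_k)` (x-indices; all other symbols zero). -/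
def gammaMap (α : ℝ) (p q : ℕ) (x : EuclideanSpace ℝ (Fin p)) (U V : GVec p q) : GVec p q :=
  ((α * ‖x‖ ^ (-(2:ℝ))) • (⟪x, V.1⟫ • U.1 + ⟪x, U.1⟫ • V.1 - ⟪U.1, V.1⟫ • x), 0)

/-- Covariant derivative `∇_U V` of a vector field `V` along the constant direction `U`, at `z`. -/
def covDeriv (α : ℝ) (p q : ℕ) (V : GVec p q → GVec p q) (z : GVec p q) (U : GVec p q) :
    GVec p q :=
  fderiv ℝ V z U + gammaMap α p q z.1 U (V z)

/-- Curvature operator `R(X,Y)Z = ∇_X ∇_Y Z − ∇_Y ∇_X Z` on constant (hence commuting) vector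
fields `X, Y, Z`, evaluated at `z`. -/
def curvOp (α : ℝ) (p q : ℕ) (z : GVec p q) (X Y Z : GVec p q) : GVec p q :=
  covDeriv α p q (fun w => gammaMap α p q w.1 Y Z) z X
    - covDeriv α p q (fun w => gammaMap α p q w.1 X Z) z Y

/-- Riemann curvature tensor `R(U,V,X,Y) = g(U, R(X,Y)V)`. -/
def riem (α : ℝ) (p q : ℕ) (z : GVec p q) (U V X Y : GVec p q) : ℝ :=
  gMet α p q z.1 U (curvOp α p q z X Y V)

/-- Ricci tensor `Ric(X,Y) = trace (V ↦ R(V,Y)X)`. -/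
def ricci (α : ℝ) (p q : ℕ) (z : GVec p q) (X Y : GVec p q) : ℝ :=
  (∑ i : Fin p, (curvOp α p q z (EuclideanSpace.single i 1, 0) Y X).1 i)
    + ∑ l : Fin q, (curvOp α p q z (0, EuclideanSpace.single l 1) Y X).2 l

/-- Scalar curvature: the `g`-trace of the Ricci tensor. -/
def scal (α : ℝ) (p q : ℕ) (z : GVec p q) : ℝ :=
  ((α + 1) ^ 2 * ‖z.1‖ ^ (2 * α))⁻¹ *
      (∑ i : Fin p, ricci α p q z (EuclideanSpace.single i 1, 0) (EuclideanSpace.single i 1, 0))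
    + ∑ l : Fin q, ricci α p q z (0, EuclideanSpace.single l 1) (0, EuclideanSpace.single l 1)

/-- The Weyl tensor
`W = R + (1/(n−2)) Ric ⊙ g − (Scal/(2(n−1)(n−2))) g ⊙ g`, where
`(h ⊙ s)(X₁,X₂,X₃,X₄) = h(X₁,X₄)s(X₂,X₃) + h(X₂,X₃)s(X₁,X₄) − h(X₁,X₃)s(X₂,X₄) − h(X₂,X₄)s(X₁,X₃)`
and `n = p + q`. -/
def weyl (α : ℝ) (p q : ℕ) (z : GVec p q) (X₁ X₂ X₃ X₄ : GVec p q) : ℝ :=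
  riem α p q z X₁ X₂ X₃ X₄
    + ((p + q : ℝ) - 2)⁻¹ *
        (ricci α p q z X₁ X₄ * gMet α p q z.1 X₂ X₃ + ricci α p q z X₂ X₃ * gMet α p q z.1 X₁ X₄
          - ricci α p q z X₁ X₃ * gMet α p q z.1 X₂ X₄
          - ricci α p q z X₂ X₄ * gMet α p q z.1 X₁ X₃)
    - scal α p q z / (2 * ((p + q : ℝ) - 1) * ((p + q : ℝ) - 2)) *
        (gMet α p q z.1 X₁ X₄ * gMet α p q z.1 X₂ X₃ + gMet α p q z.1 X₂ X₃ * gMet α p q z.1 X₁ X₄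
          - gMet α p q z.1 X₁ X₃ * gMet α p q z.1 X₂ X₄
          - gMet α p q z.1 X₂ X₄ * gMet α p q z.1 X₁ X₃)

/-- Vertical subspace `T_z S = {(v,0) : ⟨v,x⟩ = 0}`. -/
def TSp (p q : ℕ) (z : GVec p q) : Set (GVec p q) := {U | U.2 = 0 ∧ ⟪U.1, z.1⟫ = 0}

/-- Horizontal subspace `T_z H = {(t x, w) : t ∈ ℝ, w ∈ ℝ^q}`. -/
def THp (p q : ℕ) (z : GVec p q) : Set (GVec p q) := {U | ∃ t : ℝ, U.1 = t • z.1}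

/-- `g`-orthogonal projection of `U` onto the vertical subspace `T_z S`. -/
def projS (p q : ℕ) (z : GVec p q) (U : GVec p q) : GVec p q :=
  (U.1 - (⟪U.1, z.1⟫ / ‖z.1‖ ^ 2) • z.1, 0)

/-- Control (Carnot–Carathéodory) distance of the Grushin vector fields
`X_j = ∂_{x_j}`, `Y_λ = (α+1)|x|^α ∂_{y_λ}`: the infimum of `∫₀ᵀ √(|a|²+|b|²)` over absolutely
continuous admissible paths `γ̇ = Σ aⱼ Xⱼ(γ) + Σ b_λ Y_λ(γ)` joining the two points. -/
def grushinDist (α : ℝ) (p q : ℕ) (z z' : GVec p q) : ℝ :=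
  sInf { L : ℝ |
    ∃ (T : ℝ) (γ : ℝ → GVec p q) (a : ℝ → EuclideanSpace ℝ (Fin p))
      (b : ℝ → EuclideanSpace ℝ (Fin q)),
      0 ≤ T ∧ γ 0 = z ∧ γ T = z' ∧
      (∀ t ∈ Set.Icc (0:ℝ) T,
        γ t = (z.1 + ∫ s in (0:ℝ)..t, a s,
               z.2 + ∫ s in (0:ℝ)..t, ((α + 1) * ‖(γ s).1‖ ^ α) • b s)) ∧
      L = ∫ t in (0:ℝ)..T, Real.sqrt (‖a t‖ ^ 2 + ‖b t‖ ^ 2) }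


open Filter Topology in
/-- The Laplacian of a radial function `F (‖v‖ ^ 2)`, as a sum of pure second derivatives. -/
theorem sum_iteratedDeriv_two_radial {n : ℕ} (v : EuclideanSpace ℝ (Fin n))
    {F F' : ℝ → ℝ} {F'' : ℝ} {g : EuclideanSpace ℝ (Fin n) → ℝ}
    (hg : ∀ w, g w = F (‖w‖ ^ 2))
    (hF : ∀ᶠ s in 𝓝 (‖v‖ ^ 2), HasDerivAt F (F' s) s)
    (hF' : HasDerivAt F' F'' (‖v‖ ^ 2)) :
    ∑ i : Fin n, iteratedDeriv 2 (fun t : ℝ => g (v + t • EuclideanSpace.single i 1)) 0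
      = 4 * ‖v‖ ^ 2 * F'' + 2 * n * F' (‖v‖ ^ 2) := by
  have key (i : Fin n) :
      iteratedDeriv 2 (fun t : ℝ => g (v + t • EuclideanSpace.single i 1)) 0
        = 4 * F'' * v i ^ 2 + 2 * F' (‖v‖ ^ 2) := by
    have hN (t : ℝ) : ‖v + t • EuclideanSpace.single i (1 : ℝ)‖ ^ 2
        = ‖v‖ ^ 2 + 2 * v i * t + t ^ 2 := by
      rw [norm_add_sq_real, norm_smul, inner_smul_right, EuclideanSpace.inner_single_right]
      simp
      ring
    have hN' (t : ℝ) : HasDerivAt (fun t : ℝ => ‖v‖ ^ 2 + 2 * v i * t + t ^ 2)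
        (2 * v i + 2 * t) t := by
      have h := (((hasDerivAt_id t).const_mul (2 * v i)).const_add (‖v‖ ^ 2)).fun_add
        (hasDerivAt_pow 2 t)
      simpa using h
    have h0 : ‖v‖ ^ 2 + 2 * v i * 0 + (0 : ℝ) ^ 2 = ‖v‖ ^ 2 := by ring
    have htend : Tendsto (fun t : ℝ => ‖v‖ ^ 2 + 2 * v i * t + t ^ 2) (𝓝 0) (𝓝 (‖v‖ ^ 2)) := by
      simpa only [h0] using (hN' 0).continuousAt.tendsto
    simp only [hg, hN]
    rw [iteratedDeriv_succ, iteratedDeriv_one]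
    have hd : deriv (fun t : ℝ => F (‖v‖ ^ 2 + 2 * v i * t + t ^ 2)) =ᶠ[𝓝 0]
        fun t => F' (‖v‖ ^ 2 + 2 * v i * t + t ^ 2) * (2 * v i + 2 * t) := by
      filter_upwards [htend.eventually hF] with t ht
      exact (ht.comp t (hN' t)).deriv
    rw [hd.deriv_eq]
    have h1 : HasDerivAt (fun t : ℝ => F' (‖v‖ ^ 2 + 2 * v i * t + t ^ 2))
        (F'' * (2 * v i + 2 * 0)) 0 :=
      HasDerivAt.comp (0 : ℝ) (by simpa only [h0] using hF') (hN' 0)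
    have h2 : HasDerivAt (fun t : ℝ => 2 * v i + 2 * t) 2 0 := by
      simpa using ((hasDerivAt_id (0 : ℝ)).const_mul 2).const_add (2 * v i)
    rw [(h1.fun_mul h2).deriv, h0]
    ring
  simp only [key, Finset.sum_add_distrib, ← Finset.mul_sum, Finset.sum_const, Finset.card_univ,
    Fintype.card_fin, nsmul_eq_mul]
  rw [EuclideanSpace.real_norm_sq_eq]
  ring

theorem hasDerivAt_rpow_add_rpow {a b c s : ℝ} (hs : 0 < s) (hc : 0 ≤ c) :
    HasDerivAt (fun r : ℝ => (r ^ a + c) ^ b)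
      (b * (s ^ a + c) ^ (b - 1) * (a * s ^ (a - 1))) s := by
  have hu : 0 < s ^ a + c := by positivity
  have h := ((Real.hasDerivAt_rpow_const (p := a) (Or.inl hs.ne')).add_const c).rpow_const
    (p := b) (Or.inl hu.ne')
  convert h using 1
  ring

theorem hasDerivAt_const_add_rpow {b c s : ℝ} (h : 0 < c + s) :
    HasDerivAt (fun r : ℝ => (c + r) ^ b) (b * (c + s) ^ (b - 1)) s := by
  simpa using ((hasDerivAt_id s).const_add c).rpow_const (p := b) (Or.inl h.ne')

theorem homNorm_rpow (α : ℝ) (p q : ℕ) (z : GVec p q) (r : ℝ) :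
    homNorm α p q z ^ r
      = ((‖z.1‖ ^ 2) ^ (α + 1) + ‖z.2‖ ^ 2) ^ (r / (2 * (α + 1))) := by
  have h : (‖z.1‖ ^ 2) ^ (α + 1) = ‖z.1‖ ^ (2 * (α + 1)) := by
    rw [← Real.rpow_natCast, ← Real.rpow_mul (norm_nonneg _), Nat.cast_ofNat]
  rw [homNorm, h, ← Real.rpow_mul (by positivity)]
  ring_nf

/-- `Γ(z) = ‖z‖^{2−Q}`, `Q = p + (α+1)q`, solves the Grushin equation
`Δ_x Γ + (α+1)²|x|^{2α} Δ_y Γ = 0` away from `x = 0`. -/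
theorem grushin_fundamental_solution
    (α : ℝ) (hα : 0 < α) (p q : ℕ) (hp : 1 ≤ p) (hq : 1 ≤ q)
    (x : EuclideanSpace ℝ (Fin p)) (hx : x ≠ 0) (y : EuclideanSpace ℝ (Fin q)) :
    (∑ i : Fin p, iteratedDeriv 2
        (fun t : ℝ => homNorm α p q (x + t • EuclideanSpace.single i 1, y)
          ^ ((2:ℝ) - ((p : ℝ) + (α + 1) * (q : ℝ)))) 0)
      + (α + 1) ^ 2 * ‖x‖ ^ (2 * α) *
        ∑ l : Fin q, iteratedDeriv 2
          (fun t : ℝ => homNorm α p q (x, y + t • EuclideanSpace.single l 1)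
            ^ ((2:ℝ) - ((p : ℝ) + (α + 1) * (q : ℝ)))) 0
      = 0 := by
  have hs : 0 < ‖x‖ ^ 2 := by positivity
  have hc : 0 ≤ ‖y‖ ^ 2 := by positivity
  have hX : 0 < (‖x‖ ^ 2) ^ (α + 1) := by positivity
  have hu : 0 < (‖x‖ ^ 2) ^ (α + 1) + ‖y‖ ^ 2 := by positivity
  have hpow : ‖x‖ ^ (2 * α) = (‖x‖ ^ 2) ^ α := by
    rw [← Real.rpow_natCast, ← Real.rpow_mul (norm_nonneg _), Nat.cast_ofNat]
  simp only [homNorm_rpow]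
  obtain ⟨b, hb⟩ : ∃ b, b = ((2 : ℝ) - (p + (α + 1) * q)) / (2 * (α + 1)) := ⟨_, rfl⟩
  rw [← hb]
  have hb' : 2 * (α + 1) * b = 2 - (p + (α + 1) * q) := by
    rw [hb]
    field_simp
  have hxsum := sum_iteratedDeriv_two_radial x
    (g := fun w => ((‖w‖ ^ 2) ^ (α + 1) + ‖y‖ ^ 2) ^ b)
    (F := fun r => (r ^ (α + 1) + ‖y‖ ^ 2) ^ b) (fun _ => rfl)
    ((eventually_gt_nhds hs).mono fun _ hr => hasDerivAt_rpow_add_rpow hr hc)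
    (((hasDerivAt_rpow_add_rpow hs hc).const_mul b).mul
      ((Real.hasDerivAt_rpow_const (Or.inl hs.ne')).const_mul (α + 1)))
  have hysum := sum_iteratedDeriv_two_radial y
    (g := fun w => ((‖x‖ ^ 2) ^ (α + 1) + ‖w‖ ^ 2) ^ b)
    (F := fun r => ((‖x‖ ^ 2) ^ (α + 1) + r) ^ b) (fun _ => rfl)
    ((eventually_gt_nhds (show -(‖x‖ ^ 2) ^ (α + 1) < ‖y‖ ^ 2 by linarith)).mono
      fun _ hr => hasDerivAt_const_add_rpow (by linarith))
    ((hasDerivAt_const_add_rpow hu).const_mul b)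
  rw [hxsum, hysum, hpow]
  generalize ‖x‖ ^ 2 = s at *
  generalize ‖y‖ ^ 2 = c at *
  have hα1 : α + 1 - 1 = α := by ring
  have e1 : s ^ (α + 1) = s ^ α * s := Real.rpow_add_one hs.ne' α
  have e2 : s ^ (α - 1) = s ^ α / s := Real.rpow_sub_one hs.ne' α
  have e3 : (s ^ (α + 1) + c) ^ (b - 1) =
      (s ^ (α + 1) + c) ^ (b - 1 - 1) * (s ^ (α + 1) + c) := by
    rw [← Real.rpow_add_one hu.ne', sub_add_cancel]
  rw [hα1, e3, e2]
  generalize (s ^ (α + 1) + c) ^ (b - 1 - 1) = U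
  rw [e1]
  generalize s ^ α = S
  field_simp
  linear_combination (2 * U * b * (α + 1) * S * (S * s + c)) * hb'

end
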